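/- In the setting of the Local Action Lemma, assume Pr(X ∈ 𝒢) = 0, and for every α ∈ M and ε > 0 fix an element τ⁻¹_ε(α) ∈ τ⁻¹(α) with f(τ⁻¹_ε(α)) < (1+ε)·f̲(α). Let N ≥ 0 be an integer and w ∈ B* \ {1}, and write w = βv with β ∈ B and v ∈ B*. Then inf over all functions ε : E → ℝ_{>0} of the sum, over all pairs (w₀,…,w_n; α₁,…,α_n) ∈ 𝒜^ε_N(w), of P(w₀,…,w_n; α₁,…,α_n), is at most f(β). -/

import Mathlib

open MeasureTheory ENNReal

/-- `f̲(α) := inf { ∏_{i=1}^k f(β_i) : β_1, …, β_k ∈ B, β_1 ⋯ β_k = α }`. -/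
noncomputable def funderline {M : Type*} [Monoid M] (B : Set M) (f : M → ℝ≥0∞) (α : M) :
    ℝ≥0∞ :=
  ⨅ (l : List M) (_ : ∀ b ∈ l, b ∈ B) (_ : l.prod = α), (l.map f).prod

/-- The canonical homomorphism `τ : B* → M` from the free monoid on `B`. -/
noncomputable def tauHom {M : Type*} [Monoid M] (B : Set M) : FreeMonoid ↥B →* M :=
  FreeMonoid.lift fun b => (b : M)

/-- `f(w) := ∏ f(β_i)` for a word `w = β₁…β_k ∈ B*`. -/
noncomputable def fword {M : Type*} [Monoid M] {B : Set M} (f : M → ℝ≥0∞)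
    (w : FreeMonoid ↥B) : ℝ≥0∞ :=
  (w.toList.map fun b => f (b : M)).prod

/-- One admissibility step from `w` to `w'` with label `a ∈ M ∪ {*}` (`* = none`):
writing `w = β v` with `β ∈ B`, either `a = *` and `w' = v`, or `a = α ∈ M` and
`w' = u v` for some word `u` with `τ(u) = α β`. -/
def AdmStep {M : Type*} [Monoid M] (B : Set M)
    (w : FreeMonoid ↥B) (a : Option M) (w' : FreeMonoid ↥B) : Prop :=
  ∃ (β : ↥B) (v : FreeMonoid ↥B), w = FreeMonoid.of β * v ∧
    ((a = none ∧ w' = v) ∨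
      ∃ (α : M) (u : FreeMonoid ↥B), a = some α ∧ tauHom B u = α * (β : M) ∧ w' = u * v)

/-- The chain condition of an admissible pair `(w₀, …, w_n; α₁, …, α_n)`, encoded as the
initial word `w₀` together with the list of steps `[(α₁, w₁), …, (α_n, w_n)]`. -/
def AdmChain {M : Type*} [Monoid M] (B : Set M) :
    FreeMonoid ↥B → List (Option M × FreeMonoid ↥B) → Prop
  | _, [] => True
  | w, (a, w') :: rest => AdmStep B w a w' ∧ AdmChain B w' rest

/-- `P(w₀, …, w_n; α₁, …, α_n) := ∏_{k : α_k ∈ M} P(β_k, α_k)`, where `β_k` is the first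
letter of `w_{k-1}` (the value `1` used for an empty `w_{k-1}` is irrelevant: admissible
pairs have `w_{k-1} ≠ 1`). -/
noncomputable def Pval {M : Type*} [Monoid M] {B : Set M} (P : M → M → ℝ≥0∞) :
    FreeMonoid ↥B → List (Option M × FreeMonoid ↥B) → ℝ≥0∞
  | _, [] => 1
  | w, (a, w') :: rest =>
      (match a, FreeMonoid.toList w with
        | some α, b :: _ => P (b : M) α
        | _, _ => 1) * Pval P w' rest

/-- The ε-admissibility condition: for every index `k` with `α_k = some α`, writing
`w_{k-1} = β_k v_k`, we have `w_k = τ⁻¹_{ε_k}(α_k β_k) v_k` where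
`ε_k = ε(w₀, …, w_{k-1}; α₁, …, α_k)`; here `T α e` denotes `τ⁻¹_e(α)`, `w₀` is the
initial word, and the extended admissible pair `(w₀, …, w_{k-1}; α₁, …, α_k)` is encoded
as the triple (initial word `w₀`, list of the first `k-1` steps, final label `α_k`). -/
def EpsCond {M : Type*} [Monoid M] {B : Set M} (T : M → ℝ → FreeMonoid ↥B)
    (ε : FreeMonoid ↥B → List (Option M × FreeMonoid ↥B) → M → ℝ) (w₀ : FreeMonoid ↥B) :
    FreeMonoid ↥B → List (Option M × FreeMonoid ↥B) → List (Option M × FreeMonoid ↥B) →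
      Prop
  | _, _, [] => True
  | w, pre, (a, w') :: rest =>
      (∀ α : M, a = some α → ∃ (β : ↥B) (v : FreeMonoid ↥B),
          w = FreeMonoid.of β * v ∧ w' = T (α * (β : M)) (ε w₀ pre α) * v) ∧
      EpsCond T ε w₀ w' (pre ++ [(a, w')]) rest

open Classical in
/-- The weight of a nonempty path started at a word, zero unless the path follows the
deterministic rule `βv ↦ v` on label `*` and `βv ↦ U(αβ)v` on label `α`, makes at most `n` steps,
only steps from words of length at least `h`, and ends with a label in `M`. -/
noncomputable def pathWeight {M : Type*} [Monoid M] {B : Set M} (Q : M → M → ℝ≥0∞)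
    (U : M → FreeMonoid ↥B) (h : ℕ) :
    ℕ → FreeMonoid ↥B → List (Option M × FreeMonoid ↥B) → ℝ≥0∞
  | _, _, [] => 0
  | 0, _, _ :: _ => 0
  | n + 1, x, (a, w') :: rest =>
      match FreeMonoid.toList x with
      | [] => 0
      | b :: y =>
        if h ≤ y.length + 1 then
          match a with
          | none => if w' = FreeMonoid.ofList y then pathWeight Q U h n w' rest else 0
          | some α =>
            if w' = U (α * (b : M)) * FreeMonoid.ofList y then
              Q (b : M) α * (pathWeight Q U h n w' rest + if rest = [] then 1 else 0)
            else 0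
        else 0

/-- The product of `f` over the letters of a word lying above its suffix of length `h - 1`. -/
noncomputable def excess {M : Type*} [Monoid M] {B : Set M} (f : M → ℝ≥0∞) (h : ℕ)
    (x : FreeMonoid ↥B) : ℝ≥0∞ :=
  ((x.toList.take (x.toList.length + 1 - h)).map fun b : ↥B => f b).prod

theorem fword_eq_prod {M : Type*} [Monoid M] {B : Set M} (f : M → ℝ≥0∞) (x : FreeMonoid ↥B) :
    fword f x = (x.toList.map fun b : ↥B => f b).prod := by
  simp [fword]

theorem excess_mul {M : Type*} [Monoid M] {B : Set M} (f : M → ℝ≥0∞) {h : ℕ}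
    (u y : FreeMonoid ↥B) (hy : h ≤ y.toList.length + 1) :
    excess f h (u * y) = fword f u * excess f h y := by
  have e : u.toList.length + y.toList.length + 1 - h
      = u.toList.length + (y.toList.length + 1 - h) := by omega
  simp only [excess, fword_eq_prod, FreeMonoid.toList_mul, List.length_append, e,
    List.take_length_add_append, List.map_append, List.prod_append]

theorem one_le_prod_map {ι : Type*} (f : ι → ℝ≥0∞) (l : List ι)
    (hl : ∀ b ∈ l, 1 ≤ f b) : 1 ≤ (l.map f).prod := by
  induction l with
  | nil => simp
  | cons b l ih =>
    rw [List.map_cons, List.prod_cons]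
    exact one_le_mul (hl b (by simp)) (ih fun c hc => hl c (by simp [hc]))

theorem ENNReal.tsum_option {A : Type*} (F : Option A → ℝ≥0∞) :
    ∑' o, F o = F none + ∑' a, F (some a) := by
  rw [← (Equiv.optionEquivSumPUnit.{0} A).symm.tsum_eq,
    Summable.tsum_sum ENNReal.summable ENNReal.summable, add_comm]
  simp

theorem ENNReal.tsum_list {A : Type*} (F : List A → ℝ≥0∞) :
    ∑' l, F l = F [] + ∑' a, ∑' l, F (a :: l) := by
  let e : Option (A × List A) ≃ List A :=
    { toFun := fun o => o.elim [] fun p => p.1 :: p.2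
      invFun := fun l => match l with
        | [] => none
        | a :: l => some (a, l)
      left_inv := by rintro (_ | ⟨a, l⟩) <;> rfl
      right_inv := by rintro (_ | ⟨a, l⟩) <;> rfl }
  rw [← e.tsum_eq, ENNReal.tsum_option, ← ENNReal.tsum_prod (f := fun a l => F (a :: l))]
  rfl

theorem one_add_tsum_pathWeight_le {M : Type*} [Monoid M] {B : Set M} (Q : M → M → ℝ≥0∞)
    (U : M → FreeMonoid ↥B) (f : M → ℝ≥0∞)
    (hf : ∀ b ∈ B, 1 + ∑' α : M, Q b α * fword f (U (α * b)) ≤ f b) (h n : ℕ)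
    (x : FreeMonoid ↥B) :
    1 + ∑' s, pathWeight Q U h n x s ≤ excess f h x := by
  have hf1 : ∀ b ∈ B, 1 ≤ f b := fun b hb => le_self_add.trans (hf b hb)
  have hone : ∀ x : FreeMonoid ↥B, 1 ≤ excess f h x := fun _ =>
    one_le_prod_map (fun b : ↥B => f b) _ fun b _ => hf1 b b.2
  induction n generalizing x with
  | zero =>
    have : ∀ s, pathWeight Q U h 0 x s = 0 := by rintro (_ | ⟨_, _⟩) <;> simp [pathWeight]
    simpa [this] using hone x
  | succ n ih =>
    rw [ENNReal.tsum_list, pathWeight, zero_add]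
    induction x using FreeMonoid.casesOn with
    | one => simpa [pathWeight] using hone 1
    | of_mul b y =>
      by_cases hy : h ≤ y.toList.length + 1
      · have hnone : ∑' w' : FreeMonoid ↥B, ∑' s,
            pathWeight Q U h (n + 1) (FreeMonoid.of b * y) ((none, w') :: s)
            = ∑' s, pathWeight Q U h n y s := by
          rw [tsum_eq_single y]
          · simp [pathWeight, hy]
          · intro w' hw'
            simp [pathWeight, hw']
        have hsome : ∀ α : M, ∑' w' : FreeMonoid ↥B, ∑' s,
            pathWeight Q U h (n + 1) (FreeMonoid.of b * y) ((some α, w') :: s)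
            = Q b α * (1 + ∑' s, pathWeight Q U h n (U (α * b) * y) s) := by
          intro α
          rw [tsum_eq_single (U (α * b) * y)]
          · simp [pathWeight, hy, ENNReal.tsum_mul_left, ENNReal.tsum_add]
            rw [add_comm]
          · intro w' hw'
            simp [pathWeight, hw']
        rw [ENNReal.tsum_prod', ENNReal.tsum_option, hnone, ← add_assoc,
          excess_mul f _ _ hy]
        calc _ ≤ excess f h y +
              ∑' α : M, (Q b α * fword f (U (α * b))) * excess f h y := by
              gcongr with α
              · exact ih y
              · rw [hsome, mul_assoc, ← excess_mul f _ _ hy]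
                gcongr
                exact ih _
          _ = (1 + ∑' α : M, Q b α * fword f (U (α * b))) * excess f h y := by
              rw [ENNReal.tsum_mul_right, add_mul, one_mul]
          _ ≤ _ := by
              gcongr
              simpa [fword_eq_prod] using hf b b.2
      · simpa [pathWeight, hy] using hone _

open Classical in
theorem Pval_le_pathWeight {M : Type*} [Monoid M] {B : Set M} (P : M → M → ℝ≥0∞)
    (T : M → ℝ → FreeMonoid ↥B) (e : ℝ) {c : ℝ≥0∞} (hc0 : c ≠ 0) (hc : c ≠ ⊤) (h n : ℕ)
    (w₀ x : FreeMonoid ↥B) (pre s : List (Option M × FreeMonoid ↥B)) (hn : s.length ≤ n)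
    (hadm : AdmChain B x s) (heps : EpsCond T (fun _ _ _ => e) w₀ x pre s)
    (hx : h ≤ x.toList.length) (hs : ∀ p ∈ s, h ≤ p.2.toList.length)
    (hlast : s = [] ∨ ∃ p, s.getLast? = some p ∧ p.1.isSome = true) :
    Pval P x s ≤ c ^ s.countP (fun p => p.1.isSome) *
      (pathWeight (fun b α => P b α / c) (fun α => T α e) h n x s + if s = [] then 1 else 0) := by
  induction s generalizing n x pre with
  | nil => simp [Pval, pathWeight]
  | cons p rest ih =>
    obtain ⟨a, w'⟩ := p
    obtain ⟨n, rfl⟩ : ∃ m, n = m + 1 := ⟨n - 1, by simp at hn; omega⟩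
    obtain ⟨⟨b, y, rfl, hstep⟩, hadm⟩ := hadm
    obtain ⟨heps1, heps⟩ := heps
    have hlast' : rest = [] ∨ ∃ p, rest.getLast? = some p ∧ p.1.isSome = true := by
      rcases rest with _ | ⟨q, rest⟩
      · simp
      · simpa [List.getLast?_cons_cons] using hlast
    have key := ih n w' _ (by simpa using hn) hadm heps (hs (a, w') (by simp))
      (fun p hp => hs p (by simp [hp])) hlast'
    have hy : h ≤ y.toList.length + 1 := by simpa [add_comm] using hx
    rcases a with _ | α
    · obtain rfl : w' = y := by simpa using hstep
      have hrest : rest ≠ [] := by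
        rintro rfl
        simp at hlast
      simpa [Pval, pathWeight, hy, hrest] using key
    · obtain ⟨b', y', hby, rfl⟩ := heps1 α rfl
      obtain ⟨rfl, rfl⟩ : b = b' ∧ y = y' := by
        have := congrArg FreeMonoid.toList hby
        simpa using this
      simp only [Pval, pathWeight, FreeMonoid.toList_mul, FreeMonoid.toList_of,
        List.singleton_append, hy, FreeMonoid.ofList_toList, if_true, List.countP_cons,
        Option.isSome_some, pow_succ, reduceCtorEq, if_false, add_zero]
      calc _ ≤ _ := mul_le_mul_right key (P b α)
        _ = _ := by
          nth_rw 1 [← ENNReal.mul_div_cancel (a := c) (b := P b α) hc0 hc]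
          ring

/-- **Key lemma of the Local Action Lemma** (`Lemma meanbound`).  In the setting of the
Local Action Lemma, assume moreover `Pr(X ∈ 𝒢) = 0` and fix, for every `α ∈ M` and real
`e > 0`, a word `T α e = τ⁻¹_e(α) ∈ τ⁻¹(α)` with `f(τ⁻¹_e(α)) < (1+e) f̲(α)`.  Let
`N ≥ 0`, and let `w = β v ∈ B* \ {1}` with `β ∈ B`.  Then the infimum, over all positive
functions `ε` on extended admissible pairs, of the sum of `P(w₀, …, w_n; α₁, …, α_n)`
over all pairs in `𝒜^ε_N(w)` (those ε-admissible pairs with `w₀ = w`, at most `N` labels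
in `M`, `|w_k| ≥ |w₀|` for all `k`, and `n = 0` or `α_n ∈ M`) is at most `f(β)`. -/
theorem stmt_2 {𝒳 : Type*} [MeasurableSpace 𝒳] [Nonempty 𝒳]
    {M : Type*} [Monoid M] [Countable M] [MulAction M 𝒳]
    (B : Set M) (hB : Submonoid.closure B = ⊤)
    (haction_meas : ∀ α : M, Measurable fun x : 𝒳 => α • x)
    (𝒢 : Set 𝒳) (h𝒢 : MeasurableSet 𝒢)
    (hinv : ∀ x ∈ 𝒢, ∀ α : M, α • x ∈ 𝒢)
    {Ω : Type*} [MeasurableSpace Ω] (μpr : Measure Ω) [IsProbabilityMeasure μpr]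
    (X : Ω → 𝒳) (hX : Measurable X)
    (g : M → 𝒳 → M)
    (hg_meas : ∀ β α : M, MeasurableSet {x : 𝒳 | x ∉ 𝒢 ∧ β • x ∈ 𝒢 ∧ g β x = α})
    (P : M → M → ℝ≥0∞)
    (hP : ∀ β α : M, P β α = ⨆ γ : M,
      μpr {ω | (γ • X ω ∉ 𝒢 ∧ β • (γ • X ω) ∈ 𝒢 ∧ g β (γ • X ω) = α) ∧
              (α * β * γ) • X ω ∈ 𝒢} /
        μpr {ω | (α * β * γ) • X ω ∈ 𝒢})
    (f : M → ℝ≥0∞) (hf_pos : ∀ β ∈ B, 0 < f β) (hf_fin : ∀ β ∈ B, f β ≠ ⊤)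
    (hineq : ∀ β ∈ B, 1 + ∑' α : M, P β α * funderline B f (α * β) ≤ f β)
    (hzero : μpr {ω | X ω ∈ 𝒢} = 0)
    (T : M → ℝ → FreeMonoid ↥B)
    (hT : ∀ (α : M) (e : ℝ), 0 < e → tauHom B (T α e) = α ∧
      fword f (T α e) < (1 + ENNReal.ofReal e) * funderline B f α)
    (N : ℕ) (w : FreeMonoid ↥B) (β : ↥B) (v : FreeMonoid ↥B)
    (hw : w = FreeMonoid.of β * v) :
    (⨅ (ε : FreeMonoid ↥B → List (Option M × FreeMonoid ↥B) → M → ℝ)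
        (_ : ∀ w₀ pre α, 0 < ε w₀ pre α),
      ∑' s : {steps : List (Option M × FreeMonoid ↥B) //
          AdmChain B w steps ∧
          (∀ u ∈ w :: steps.map Prod.snd, 0 < μpr {ω | tauHom B u • X ω ∈ 𝒢}) ∧
          EpsCond T ε w w [] steps ∧
          steps.countP (fun p => p.1.isSome) ≤ N ∧
          (∀ p ∈ steps, w.toList.length ≤ p.2.toList.length) ∧
          (steps = [] ∨ ∃ p, steps.getLast? = some p ∧ p.1.isSome = true)},
        Pval P w s.val) ≤ f (β : M) := by
  have hexc : excess f w.toList.length w = f β := by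
    rw [hw, excess_mul f _ _ (by simp [add_comm])]
    simp [excess, fword_eq_prod]
  have hlim : Filter.Tendsto (fun e : ℝ => (1 + ENNReal.ofReal e) ^ N * f (β : M))
      (nhdsWithin 0 (Set.Ioi 0)) (nhds (f β)) := by
    have : Filter.Tendsto (fun e : ℝ => (1 + ENNReal.ofReal e) ^ N * f (β : M))
        (nhds 0) (nhds ((1 + ENNReal.ofReal 0) ^ N * f β)) := by
      refine ENNReal.Tendsto.mul_const (ENNReal.Tendsto.pow ?_) (.inr (hf_fin β β.2))
      exact tendsto_const_nhds.add (ENNReal.continuous_ofReal.tendsto 0)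
    simpa using this.mono_left nhdsWithin_le_nhds
  refine ge_of_tendsto hlim (Filter.eventually_of_mem self_mem_nhdsWithin fun e he => ?_)
  replace he : 0 < e := he
  refine iInf₂_le_of_le (fun _ _ _ => e) (fun _ _ _ => he) ?_
  have hc0 : 1 + ENNReal.ofReal e ≠ 0 := by simp
  have hc : 1 + ENNReal.ofReal e ≠ ⊤ := by simp
  have hQ : ∀ b ∈ B, 1 + ∑' α : M,
      P b α / (1 + ENNReal.ofReal e) * fword f (T (α * b) e) ≤ f b := by
    intro b hb
    refine le_trans ?_ (hineq b hb)
    gcongr 1 + ∑' α, ?_ with α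
    calc _ ≤ P b α / (1 + ENNReal.ofReal e) *
          ((1 + ENNReal.ofReal e) * funderline B f (α * b)) := by
          gcongr
          exact (hT _ e he).2.le
      _ = _ := by rw [← mul_assoc, ENNReal.div_mul_cancel hc0 hc]
  rw [ENNReal.tsum_eq_iSup_sum]
  refine iSup_le fun S => ?_
  classical
  let n := S.sup fun s => s.val.length
  let F : List (Option M × FreeMonoid ↥B) → ℝ≥0∞ := fun s =>
    pathWeight (fun b α => P b α / (1 + ENNReal.ofReal e)) (fun α => T α e)
      w.toList.length n w s + if s = [] then 1 else 0
  calc _ ≤ ∑ s ∈ S, (1 + ENNReal.ofReal e) ^ N * F s.val := by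
        refine Finset.sum_le_sum fun s hs => ?_
        obtain ⟨hadm, -, heps, hN, hl, hlast⟩ := s.2
        refine (Pval_le_pathWeight P T e hc0 hc w.toList.length n w w [] s.val
          (Finset.le_sup (f := fun s => s.val.length) hs) hadm heps le_rfl hl hlast).trans ?_
        dsimp only [F]
        gcongr
        exact le_self_add
    _ = (1 + ENNReal.ofReal e) ^ N * ∑ s ∈ S, F s.val := by rw [Finset.mul_sum]
    _ ≤ (1 + ENNReal.ofReal e) ^ N * ∑' s, F s := by
        gcongr
        exact (ENNReal.sum_le_tsum S).trans
          (ENNReal.tsum_comp_le_tsum_of_injective Subtype.val_injective F)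
    _ ≤ (1 + ENNReal.ofReal e) ^ N * f β := by
        gcongr
        rw [← hexc, ENNReal.tsum_add, tsum_ite_eq, add_comm]
        exact one_add_tsum_pathWeight_le (fun b α => P b α / (1 + ENNReal.ofReal e))
          (fun α => T α e) f hQ _ _ _
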